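/- Let n ≥ 3, let h, a, f be continuous real functions on the closed ball of radius 2 in ℝⁿ with f ≥ 0 and a ≥ 0 on B₀(2), and let u be a positive C² function on B₀(2) satisfying −Δu + h u = f u^{2*−1} + a u^{−(2*+1)} pointwise on B₀(2). Then for every real number k ≥ 2* + 2 and every nonnegative smooth function η compactly supported in B₀(2), the Caccioppoli-type energy estimate holds: (4(k−1)/(k+1)²) ∫_{B₀(2)} η² |∇(u^{(k+1)/2})|² dx ≤ ∫_{B₀(2)} ( η² f u^{k+2*−1} + η² a u^{k−2*−1} − η² h u^{k+1} ) dx + ∫_{B₀(2)} |∇η|² u^{k+1} dx. -/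

import Mathlib

open MeasureTheory Metric Real

noncomputable section

/-- Euclidean space ℝⁿ. -/
abbrev E (n : ℕ) := EuclideanSpace ℝ (Fin n)

/-- Partial derivative in the `i`-th coordinate direction. -/
noncomputable def pder {n : ℕ} (i : Fin n) (u : E n → ℝ) (x : E n) : ℝ :=
  fderiv ℝ u x (EuclideanSpace.single i 1)

/-- The Euclidean Laplacian `Δu = ∑ᵢ ∂²u/∂xᵢ²`. -/
noncomputable def lap {n : ℕ} (u : E n → ℝ) (x : E n) : ℝ :=
  ∑ i, pder i (pder i u) x

/-- The critical Sobolev exponent `2* = 2n/(n-2)`. -/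
noncomputable def twoStar (n : ℕ) : ℝ := 2 * n / ((n : ℝ) - 2)

section Auxiliary

variable {n : ℕ}

theorem gradient_apply_eq_pder (g : E n → ℝ) (x : E n) (i : Fin n) :
    gradient g x i = pder i g x := by
  have h1 : inner ℝ (gradient g x) (EuclideanSpace.single i (1 : ℝ)) = pder i g x := by
    simp only [gradient, InnerProductSpace.toDual_symm_apply, pder]
  rw [← h1, EuclideanSpace.inner_single_right]
  simp

theorem norm_gradient_sq (g : E n → ℝ) (x : E n) :
    ‖gradient g x‖ ^ 2 = ∑ i, pder i g x ^ 2 := by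
  rw [EuclideanSpace.norm_sq_eq]
  simp only [gradient_apply_eq_pder, norm_eq_abs, sq_abs]

theorem integrable_of_continuousOn_of_eq_zero {g : E n → ℝ} {U K : Set (E n)}
    (hg : ContinuousOn g U) (hK : IsCompact K) (hKU : K ⊆ U) (h0 : ∀ x ∉ K, g x = 0) :
    Integrable g :=
  ((hg.mono hKU).integrableOn_compact hK).integrable_of_forall_notMem_eq_zero h0

theorem pder_eq_zero_of_notMem_tsupport {g : E n → ℝ} {x : E n} (hx : x ∉ tsupport g)
    (i : Fin n) : pder i g x = 0 := by
  have h : fderiv ℝ g x = 0 :=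
    Function.notMem_support.1 fun hm => hx (support_fderiv_subset ℝ hm)
  simp [pder, h]

theorem integral_pder_eq_zero {g : E n → ℝ} (hg : ContDiff ℝ 1 g) (hc : HasCompactSupport g)
    (i : Fin n) : Integrable (pder i g) ∧ ∫ x, pder i g x = 0 := by
  have hcont : Continuous (pder i g) := (hg.continuous_fderiv one_ne_zero).clm_apply
    continuous_const
  have hint : Integrable (pder i g) :=
    integrable_of_continuousOn_of_eq_zero (U := Set.univ) hcont.continuousOn hc
      (Set.subset_univ _) fun x hx => pder_eq_zero_of_notMem_tsupport hx i
  refine ⟨hint, ?_⟩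
  have hpder : pder i g = fun x => fderiv ℝ g x (EuclideanSpace.single i 1) := rfl
  have := integral_mul_fderiv_eq_neg_fderiv_mul_of_integrable (μ := (volume : Measure (E n)))
    (f := g) (g := fun _ => (1 : ℝ)) (v := EuclideanSpace.single i 1)
    (by simpa [hpder] using hint) (by simp)
    (by simpa using hg.continuous.integrable_of_hasCompactSupport hc)
    (fun x _ => hg.differentiable one_ne_zero x) (fun _ _ => differentiableAt_const _)
  simpa [hpder] using this

theorem contDiffAt_pder {u : E n → ℝ} {x : E n} (hu : ContDiffAt ℝ 2 u x) (i : Fin n) :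
    ContDiffAt ℝ 1 (pder i u) x :=
  (hu.fderiv_right (m := 1) (by norm_num)).clm_apply contDiffAt_const

theorem pder_rpow {u : E n → ℝ} {x : E n} (hu : DifferentiableAt ℝ u x) (hx : 0 < u x)
    (p : ℝ) (i : Fin n) :
    pder i (fun y => u y ^ p) x = p * u x ^ (p - 1) * pder i u x := by
  simp [pder, (hu.hasFDerivAt.rpow_const (p := p) (Or.inl hx.ne')).fderiv]

theorem pder_mul {v w : E n → ℝ} {x : E n} (hv : DifferentiableAt ℝ v x)
    (hw : DifferentiableAt ℝ w x) (i : Fin n) :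
    pder i (fun y => v y * w y) x = v x * pder i w x + w x * pder i v x := by
  simp [pder, fderiv_fun_mul hv hw]

theorem pder_sq {v : E n → ℝ} {x : E n} (hv : DifferentiableAt ℝ v x) (i : Fin n) :
    pder i (fun y => v y ^ 2) x = 2 * v x * pder i v x := by
  simp only [pow_two, pder_mul hv hv]
  ring

/-- Expansion of the divergence of `η² u^k ∇u`. -/
theorem pder_sq_mul_rpow_mul_pder {u η : E n → ℝ} {x : E n} (hu : ContDiffAt ℝ 2 u x)
    (hx : 0 < u x) (hη : DifferentiableAt ℝ η x) (k : ℝ) (i : Fin n) :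
    pder i (fun y => η y ^ 2 * u y ^ k * pder i u y) x
      = η x ^ 2 * u x ^ k * pder i (pder i u) x
        + k * (η x ^ 2 * u x ^ (k - 1) * pder i u x ^ 2)
        + 2 * (η x * u x ^ k * (pder i η x * pder i u x)) := by
  have hd : DifferentiableAt ℝ u x := hu.differentiableAt two_ne_zero
  have hs : DifferentiableAt ℝ (fun y => η y ^ 2) x := hη.pow 2
  have hp : DifferentiableAt ℝ (fun y => u y ^ k) x := hd.rpow_const (Or.inl hx.ne')
  rw [pder_mul (v := fun y => η y ^ 2 * u y ^ k) (hs.mul hp)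
      ((contDiffAt_pder hu i).differentiableAt one_ne_zero),
    pder_mul hs hp, pder_sq hη, pder_rpow hd hx]
  ring

/-- Young's inequality for the cross term in the energy identity. -/
theorem sub_one_mul_le_energy {s k e p q : ℝ} (hs : 0 < s) :
    (k - 1) * (e ^ 2 * s ^ (k - 1) * p ^ 2)
      ≤ k * (e ^ 2 * s ^ (k - 1) * p ^ 2) + 2 * (e * s ^ k * (q * p)) + q ^ 2 * s ^ (k + 1) := by
  have h1 : s ^ k = s ^ (k - 1) * s := by
    rw [← rpow_add_one hs.ne']; ring_nf
  have h2 : s ^ (k + 1) = s ^ (k - 1) * s * s := by rw [rpow_add_one hs.ne', h1]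
  rw [h1, h2]
  nlinarith [mul_nonneg (rpow_pos_of_pos hs (k - 1)).le (sq_nonneg (e * p + q * s))]

theorem norm_gradient_rpow_sq {u : E n → ℝ} {x : E n} (hu : DifferentiableAt ℝ u x)
    (hx : 0 < u x) {k : ℝ} (hk : k + 1 ≠ 0) :
    4 * (k - 1) / (k + 1) ^ 2 * ‖gradient (fun y => u y ^ ((k + 1) / 2)) x‖ ^ 2
      = ∑ i, (k - 1) * (u x ^ (k - 1) * pder i u x ^ 2) := by
  have h : u x ^ (k - 1) = (u x ^ ((k + 1) / 2 - 1)) ^ 2 := by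
    rw [← rpow_mul_natCast hx.le]; congr 1; push_cast; ring
  rw [norm_gradient_sq, Finset.mul_sum]
  refine Finset.sum_congr rfl fun i _ => ?_
  rw [pder_rpow hu hx, h]
  field_simp
  ring

end Auxiliary

/-- Caccioppoli-type energy estimate: if `u > 0` solves
`−Δu + h u = f u^{2*−1} + a u^{−(2*+1)}` on `B₀(2)` with `f, a ≥ 0`, then for every
`k ≥ 2* + 2` and every nonnegative smooth `η` compactly supported in `B₀(2)`,
`(4(k−1)/(k+1)²) ∫ η² |∇(u^{(k+1)/2})|² ≤ ∫ (η² f u^{k+2*−1} + η² a u^{k−2*−1} − η² h u^{k+1})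
  + ∫ |∇η|² u^{k+1}`. -/
theorem caccioppoli_einstein_lichnerowicz
    (n : ℕ) (hn : 3 ≤ n) (h a f u : E n → ℝ)
    (hh : ContinuousOn h (closedBall 0 2))
    (ha : ContinuousOn a (closedBall 0 2))
    (hf : ContinuousOn f (closedBall 0 2))
    (hfpos : ∀ x ∈ closedBall (0 : E n) 2, 0 ≤ f x)
    (hapos : ∀ x ∈ closedBall (0 : E n) 2, 0 ≤ a x)
    (hu : ContDiffOn ℝ 2 u (ball 0 2))
    (hupos : ∀ x ∈ ball (0 : E n) 2, 0 < u x)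
    (heq : ∀ x ∈ ball (0 : E n) 2,
      -lap u x + h x * u x
        = f x * u x ^ (twoStar n - 1) + a x * u x ^ (-(twoStar n + 1)))
    (k : ℝ) (hk : twoStar n + 2 ≤ k)
    (η : E n → ℝ) (hη : ContDiff ℝ (⊤ : ℕ∞) η) (hηc : HasCompactSupport η)
    (hηsupp : tsupport η ⊆ ball (0 : E n) 2) (hηpos : ∀ x, 0 ≤ η x) :
    (4 * (k - 1) / (k + 1) ^ 2) *
        ∫ x in ball (0 : E n) 2,
          η x ^ 2 * ‖gradient (fun y => u y ^ ((k + 1) / 2)) x‖ ^ 2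
      ≤ (∫ x in ball (0 : E n) 2,
            (η x ^ 2 * f x * u x ^ (k + twoStar n - 1)
              + η x ^ 2 * a x * u x ^ (k - twoStar n - 1)
              - η x ^ 2 * h x * u x ^ (k + 1)))
        + ∫ x in ball (0 : E n) 2, ‖gradient η x‖ ^ 2 * u x ^ (k + 1) := by
  have hts : 0 < twoStar n := by
    have : (3 : ℝ) ≤ n := by exact_mod_cast hn
    exact div_pos (by linarith) (by linarith)
  have huAt : ∀ x ∈ ball (0 : E n) 2, ContDiffAt ℝ 2 u x := fun x hx =>
    hu.contDiffAt (isOpen_ball.mem_nhds hx)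
  have hηd : Differentiable ℝ η := hη.differentiable (by simp)
  have hη0 : ∀ x ∉ tsupport η, η x = 0 := fun x hx => image_eq_zero_of_notMem_tsupport hx
  have hrpow : ∀ p : ℝ, ContinuousOn (fun x => u x ^ p) (ball (0 : E n) 2) := fun p =>
    hu.continuousOn.rpow_const fun x hx => Or.inl (hupos x hx).ne'
  have hFdiff : ∀ i, ContDiff ℝ 1 fun y => η y ^ 2 * u y ^ k * pder i u y := by
    intro i
    rw [contDiff_iff_contDiffAt]
    intro x
    by_cases hx : x ∈ tsupport η
    · have hxb := hηsupp hx
      have hη1 : ContDiffAt ℝ 1 η x := hη.contDiffAt.of_le (by exact_mod_cast le_top)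
      exact ((hη1.pow 2).mul (((huAt x hxb).of_le (by norm_num)).rpow_const_of_ne
        (hupos x hxb).ne')).mul (contDiffAt_pder (huAt x hxb) i)
    · refine (contDiffAt_const (c := (0 : ℝ))).congr_of_eventuallyEq ?_
      filter_upwards [(isClosed_tsupport η).isOpen_compl.mem_nhds hx] with y hy
      simp [hη0 y hy]
  have hFsupp : ∀ i, HasCompactSupport fun y => η y ^ 2 * u y ^ k * pder i u y := fun i =>
    HasCompactSupport.intro hηc fun x hx => by simp [hη0 x hx]
  have hdiv := fun i => integral_pder_eq_zero (hFdiff i) (hFsupp i) i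
  set D : E n → ℝ := fun x => ∑ i, pder i (fun y => η y ^ 2 * u y ^ k * pder i u y) x with hD
  have hDint : Integrable D := integrable_finsetSum _ fun i _ => (hdiv i).1
  have hDzero : ∫ x in ball (0 : E n) 2, D x = 0 := by
    rw [setIntegral_eq_integral_of_forall_compl_eq_zero, integral_finsetSum _ fun i _ => (hdiv i).1]
    · exact Finset.sum_eq_zero fun i _ => (hdiv i).2
    · intro x hx
      refine Finset.sum_eq_zero fun i _ => pder_eq_zero_of_notMem_tsupport (fun hm => hx ?_) i
      exact hηsupp (closure_mono (fun y hy => by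
        contrapose! hy
        simp [Function.notMem_support.1 hy]) hm)
  have hsub : ball (0 : E n) 2 ⊆ closedBall 0 2 := ball_subset_closedBall
  have hηsq : ContinuousOn (fun x => η x ^ 2) (ball (0 : E n) 2) :=
    (hη.continuous.pow 2).continuousOn
  have hRint : Integrable fun x => η x ^ 2 * f x * u x ^ (k + twoStar n - 1)
      + η x ^ 2 * a x * u x ^ (k - twoStar n - 1) - η x ^ 2 * h x * u x ^ (k + 1) :=
    integrable_of_continuousOn_of_eq_zero
      ((((hηsq.mul (hf.mono hsub)).mul (hrpow _)).add
        ((hηsq.mul (ha.mono hsub)).mul (hrpow _))).sub ((hηsq.mul (hh.mono hsub)).mul (hrpow _)))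
      hηc hηsupp fun x hx => by simp [hη0 x hx]
  have hNint : Integrable fun x => ‖gradient η x‖ ^ 2 * u x ^ (k + 1) := by
    refine integrable_of_continuousOn_of_eq_zero (ContinuousOn.mul ?_ (hrpow _)) hηc hηsupp
      fun x hx => ?_
    · simp only [norm_gradient_sq]
      exact (continuous_finsetSum _ fun i _ => ((hη.continuous_fderiv (by simp)).clm_apply
        continuous_const).pow 2).continuousOn
    · simp [norm_gradient_sq, pder_eq_zero_of_notMem_tsupport hx]
  rw [← integral_const_mul, ← integral_add hRint.integrableOn hNint.integrableOn]
  rw [← add_zero (∫ x in ball (0 : E n) 2, _ + _), ← hDzero,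
    ← integral_add (by exact (hRint.add hNint).integrableOn) hDint.integrableOn]
  refine integral_mono_of_nonneg (ae_of_all _ fun x => ?_)
    ((hRint.add hNint).add hDint).integrableOn
    ((ae_restrict_iff' measurableSet_ball).2 (ae_of_all _ fun x hx => ?_))
  · have : 0 ≤ k - 1 := by linarith
    positivity
  have hx0 := hupos x hx
  have hR : η x ^ 2 * f x * u x ^ (k + twoStar n - 1)
      + η x ^ 2 * a x * u x ^ (k - twoStar n - 1) - η x ^ 2 * h x * u x ^ (k + 1)
      = -∑ i, η x ^ 2 * u x ^ k * pder i (pder i u) x := by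
    have e1 : u x ^ (k + twoStar n - 1) = u x ^ k * u x ^ (twoStar n - 1) := by
      rw [← rpow_add hx0]; ring_nf
    have e2 : u x ^ (k - twoStar n - 1) = u x ^ k * u x ^ (-(twoStar n + 1)) := by
      rw [← rpow_add hx0]; ring_nf
    rw [e1, e2, rpow_add_one hx0.ne', ← Finset.mul_sum]
    have := heq x hx
    rw [lap] at this
    linear_combination (-(η x ^ 2 * u x ^ k)) * this
  have hL := norm_gradient_rpow_sq ((huAt x hx).differentiableAt two_ne_zero) hx0
    (k := k) (by linarith)
  simp only [hR, hD, norm_gradient_sq η, Finset.sum_mul, ← Finset.sum_neg_distrib,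
    ← Finset.sum_add_distrib]
  rw [mul_left_comm, hL, Finset.mul_sum]
  refine Finset.sum_le_sum fun i _ => ?_
  rw [pder_sq_mul_rpow_mul_pder (huAt x hx) hx0 (hηd x)]
  have := sub_one_mul_le_energy (k := k) (e := η x) (p := pder i u x) (q := pder i η x) hx0
  linarith

end
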